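/- arXiv:2210.00839 — 3 statements merged into one kernel-verified Lean document; each statement's English description precedes it below -/
import Mathlib

section
/- Let 𝒫 be a unitary topological operad and X a pointed space. Every element (f_1, f_2, …) of C_𝒫(X) is determined by its first component f_1 : 𝒫(1) → X: for every r ≥ 2 and every θ ∈ 𝒫(r), at most one of the points f_1(D_1(θ)), …, f_1(D_r(θ)) differs from the basepoint of X, and f_r(θ) = (f_1(D_1(θ)), …, f_1(D_r(θ))) ∈ X^{∨r}. -/
universe u v

/-- A unitary topological operad `𝒫` (with `𝒫(0) = {*}`), recorded through the data that is
relevant for the comonad construction: the spaces `𝒫(r)`, the operadic unit, the symmetric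
group actions, the restriction operators `d_i` (insertion of the unique nullary operation),
the composite restriction operators `D_i = d_1 ⋯ d̂_i ⋯ d_r`, and the unary composition
`γ : 𝒫(1) × 𝒫(1) → 𝒫(1)`. -/
structure UnitaryTopOperad : Type 1 where
  ops : ℕ → Type
  topology : ∀ r, TopologicalSpace (ops r)
  one : ops 1
  act : ∀ r : ℕ, Equiv.Perm (Fin r) → ops r → ops r
  act_continuous : ∀ r σ, Continuous (act r σ)
  act_one : ∀ r x, act r 1 x = x
  act_mul : ∀ r (σ τ : Equiv.Perm (Fin r)) x, act r (σ * τ) x = act r τ (act r σ x)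
  d : ∀ r : ℕ, Fin (r + 1) → ops (r + 1) → ops r
  d_continuous : ∀ r i, Continuous (d r i)
  D : ∀ r : ℕ, Fin (r + 1) → ops (r + 1) → ops 1
  D_continuous : ∀ r i, Continuous (D r i)
  D_zero : ∀ (i : Fin 1) x, D 0 i x = x
  D_d : ∀ (r : ℕ) (j : Fin (r + 2)) (i : Fin (r + 1)) (θ : ops (r + 2)),
    D r i (d (r + 1) j θ) = D (r + 1) (j.succAbove i) θ
  act_D : ∀ (r : ℕ) (σ : Equiv.Perm (Fin (r + 1))) (i : Fin (r + 1)) (θ : ops (r + 1)),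
    D r i (act (r + 1) σ θ) = D r (σ i) θ
  comp₁ : ops 1 → ops 1 → ops 1
  comp₁_continuous : Continuous fun p : ops 1 × ops 1 => comp₁ p.1 p.2
  comp₁_assoc : ∀ a b c, comp₁ (comp₁ a b) c = comp₁ a (comp₁ b c)
  comp₁_one_left : ∀ a, comp₁ one a = a
  comp₁_one_right : ∀ a, comp₁ a one = a

attribute [instance] UnitaryTopOperad.topology

/-- A tuple `v ∈ X^{×r}` lies in the wedge `X^{∨r} ⊆ X^{×r}` iff at most one coordinate
differs from the basepoint. -/
def InWedge {X : Type u} (x₀ : X) {r : ℕ} (v : Fin r → X) : Prop :=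
  ∀ i j : Fin r, v i ≠ x₀ → v j ≠ x₀ → i = j

/-- An element of `C_𝒫(X)`: a sequence of `S_r`-equivariant continuous maps
`f_r : 𝒫(r) → X^{∨r}` (for `r ≥ 1`, indexed here by `r+1`), compatible with the restriction
operators and the wedge collapse maps. -/
structure CSeq (P : UnitaryTopOperad) (X : Type u) [TopologicalSpace X] (x₀ : X) where
  f : ∀ r : ℕ, C(P.ops (r + 1), Fin (r + 1) → X)
  mem_wedge : ∀ (r : ℕ) (θ : P.ops (r + 1)), InWedge x₀ (f r θ)
  equivariant : ∀ (r : ℕ) (σ : Equiv.Perm (Fin (r + 1))) (θ : P.ops (r + 1)) (i : Fin (r + 1)),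
    f r (P.act (r + 1) σ θ) i = f r θ (σ i)
  compat : ∀ (r : ℕ) (i : Fin (r + 2)) (θ : P.ops (r + 2)) (j : Fin (r + 1)),
    f r (P.d (r + 1) i θ) j = f (r + 1) θ (i.succAbove j)

/-- `C_𝒫(X)` carries the topology induced from `∏_{r ≥ 1} Map(𝒫(r), X^{×r})`
(compact-open topologies). -/
instance (P : UnitaryTopOperad) (X : Type u) [TopologicalSpace X] (x₀ : X) :
    TopologicalSpace (CSeq P X x₀) :=
  TopologicalSpace.induced (fun α => α.f) inferInstance

/-- Each coordinate of `f_r(θ)` is obtained by applying `f_1` to a restriction of `θ`. -/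
theorem CSeq.f_apply_eq {P : UnitaryTopOperad} {X : Type u} [TopologicalSpace X] {x₀ : X}
    (α : CSeq P X x₀) (r : ℕ) (θ : P.ops (r + 1)) (i : Fin (r + 1)) :
    α.f r θ i = α.f 0 (P.D r i θ) 0 := by
  induction r with
  | zero => rw [P.D_zero, Fin.fin_one_eq_zero i]
  | succ r ih =>
    obtain ⟨j, hj⟩ := exists_ne i
    obtain ⟨k, rfl⟩ := Fin.exists_succAbove_eq hj.symm
    rw [← α.compat, ih, P.D_d]

/-- A sequence in `C_𝒫(X)` is determined by its underlying maps. -/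
theorem CSeq.ext_f {P : UnitaryTopOperad} {X : Type u} [TopologicalSpace X] {x₀ : X}
    {α β : CSeq P X x₀} (h : α.f = β.f) : α = β := by
  cases α
  cases β
  congr

theorem statement0 (P : UnitaryTopOperad) (X : Type u) [TopologicalSpace X] (x₀ : X) :
    (∀ α β : CSeq P X x₀, α.f 0 = β.f 0 → α = β) ∧
    (∀ (α : CSeq P X x₀) (r : ℕ) (θ : P.ops (r + 2)),
      InWedge x₀ (fun i : Fin (r + 2) => α.f 0 (P.D (r + 1) i θ) 0) ∧
      ∀ i : Fin (r + 2), α.f (r + 1) θ i = α.f 0 (P.D (r + 1) i θ) 0) := by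
  refine ⟨fun α β h => CSeq.ext_f ?_, fun α r θ => ⟨?_, α.f_apply_eq (r + 1) θ⟩⟩
  · funext r
    ext θ i
    rw [α.f_apply_eq, β.f_apply_eq, h]
  · simpa only [← α.f_apply_eq] using α.mem_wedge (r + 1) θ
end

section
/- Let 𝒫 be a unitary topological operad and X a pointed space. The map (f_1, f_2, …) ↦ f_1 is a homeomorphism from C_𝒫(X) onto the subspace of Map(𝒫(1), X) (compact-open topology) consisting of those continuous maps f such that for every r ≥ 2 and every θ ∈ 𝒫(r), f(D_i(θ)) equals the basepoint for all indices 1 ≤ i ≤ r except at most one; in particular for such f each induced map f_r := (f∘D_1, …, f∘D_r) : 𝒫(r) → X^{×r} lands in X^{∨r} and is S_r-equivariant. Under this identification, for a pointed map φ : X → Y the induced map C_𝒫(φ) : C_𝒫(X) → C_𝒫(Y) is postcomposition, f ↦ φ ∘ f. -/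
universe u v

/-- The distinguished subspace of `Map(𝒫(1), X)`: continuous maps `f` such that for every
`r ≥ 2` and every `θ ∈ 𝒫(r)`, at most one of the points `f(D_1 θ), …, f(D_r θ)` differs
from the basepoint. -/
def GoodMap (P : UnitaryTopOperad) {X : Type u} [TopologicalSpace X] (x₀ : X)
    (f : C(P.ops 1, X)) : Prop :=
  ∀ (r : ℕ) (θ : P.ops (r + 2)), InWedge x₀ (fun i : Fin (r + 2) => f (P.D (r + 1) i θ))

/-- The functorial action of `C_𝒫` on a pointed continuous map, given by postcomposition. -/
def CSeq.map {P : UnitaryTopOperad} {X Y : Type u} [TopologicalSpace X] [TopologicalSpace Y]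
    {x₀ : X} {y₀ : Y} (φ : C(X, Y)) (hφ : φ x₀ = y₀) (α : CSeq P X x₀) : CSeq P Y y₀ where
  f r := ⟨fun θ i => φ (α.f r θ i),
    continuous_pi fun i => φ.continuous.comp ((continuous_apply i).comp (α.f r).continuous)⟩
  mem_wedge r θ i j hi hj :=
    α.mem_wedge r θ i j (fun h => hi (by simp only [ContinuousMap.coe_mk]; rw [h, hφ]))
      (fun h => hj (by simp only [ContinuousMap.coe_mk]; rw [h, hφ]))
  equivariant r σ θ i := congrArg φ (α.equivariant r σ θ i)
  compat r i θ j := congrArg φ (α.compat r i θ j)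

open Set Topology in
/-- A family of continuous maps into the wedge `X^{∨n}` is continuous for the compact-open topology
as soon as all its coordinates are; no separation axioms are needed. -/
theorem continuous_of_inWedge {X : Type*} {A Z : Type*} [TopologicalSpace X] [TopologicalSpace A]
    [TopologicalSpace Z] {x₀ : X} {n : ℕ} (F : Z → C(A, Fin n → X))
    (hw : ∀ z a, InWedge x₀ (F z a)) (G : Fin n → Z → C(A, X)) (hG : ∀ i, Continuous (G i))
    (hFG : ∀ z a i, F z a i = G i z a) : Continuous F := by
  rw [ContinuousMap.continuous_compactOpen]
  intro K hK U hU
  let V : Fin n → Set X := fun i => {x | Function.update (fun _ => x₀) i x ∈ U}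
  have hV : ∀ i, IsOpen (V i) := fun i => hU.preimage (continuous_const.update i continuous_id)
  have eq_update : ∀ v : Fin n → X, InWedge x₀ v → ∀ i, v i ≠ x₀ →
      Function.update (fun _ => x₀) i (v i) = v := by
    intro v hv i hi
    rw [Function.update_eq_iff]
    refine ⟨rfl, fun j hj => ?_⟩
    by_contra h
    exact hj (hv j i (Ne.symm h) hi)
  by_cases hb : (fun _ => x₀ : Fin n → X) ∈ U
  · have hmem : ∀ v : Fin n → X, InWedge x₀ v → (v ∈ U ↔ ∀ i, v i ∈ V i) := by
      intro v hv
      by_cases h : ∃ i, v i ≠ x₀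
      · obtain ⟨i, hi⟩ := h
        refine ⟨fun hvU j => ?_, fun h => ?_⟩
        · by_cases hj : v j = x₀
          · simpa [V, hj] using hb
          · simpa [V, eq_update v hv j hj] using hvU
        · simpa [V, eq_update v hv i hi] using h i
      · push Not at h
        obtain rfl : v = fun _ => x₀ := funext h
        simp [V, hb]
    have : {z | MapsTo (F z) K U} = ⋂ i, {z | MapsTo (G i z) K (V i)} := by
      ext z
      simp only [mem_ofPred_eq, mem_iInter, MapsTo]
      simp_rw [hmem _ (hw z _), hFG]
      exact ⟨fun h i a ha => h ha i, fun h a ha i => h i ha⟩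
    rw [this]
    exact isOpen_iInter_of_finite fun i =>
      (ContinuousMap.isOpen_setOfPred_mapsTo hK (hV i)).preimage (hG i)
  · have hne : ∀ i, ∀ x ∈ V i, x ≠ x₀ := by
      rintro i x hx rfl
      exact hb (by simpa [V] using hx)
    have hmem : ∀ v : Fin n → X, InWedge x₀ v → (v ∈ U ↔ ∃ i, v i ∈ V i) := by
      intro v hv
      refine ⟨fun hvU => ?_, fun ⟨i, hi⟩ => ?_⟩
      · have h : ∃ i, v i ≠ x₀ := by
          by_contra! h
          exact hb (funext h ▸ hvU)
        obtain ⟨i, hi⟩ := h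
        exact ⟨i, by simpa [V, eq_update v hv i hi] using hvU⟩
      · simpa [V, eq_update v hv i (hne i _ hi)] using hi
    rw [isOpen_iff_mem_nhds]
    intro z hz
    let L : Fin n → Set A := fun i => K ∩ G i z ⁻¹' V i
    have hL : ∀ i, IsCompact (L i) := by
      intro i
      have : L i = K \ ⋃ j ∈ {j | j ≠ i}, G j z ⁻¹' V j := by
        ext a
        simp only [L, mem_inter_iff, mem_preimage, mem_sdiff, mem_iUnion, mem_ofPred_eq,
          exists_prop, not_exists, not_and, and_congr_right_iff]
        intro ha
        refine ⟨fun hi j hji hj => hji (hw z a j i ?_ ?_), fun h => ?_⟩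
        · rw [hFG]; exact hne j _ hj
        · rw [hFG]; exact hne i _ hi
        · obtain ⟨j, hj⟩ := (hmem _ (hw z a)).1 (hz ha)
          rw [hFG] at hj
          by_cases hji : j = i
          · exact hji ▸ hj
          · exact absurd hj (h j hji)
      rw [this]
      exact hK.diff (isOpen_biUnion fun j _ => (hV j).preimage (G j z).continuous)
    have hev : ∀ i, ∀ᶠ z' in 𝓝 z, MapsTo (G i z') (L i) (V i) := fun i =>
      ((ContinuousMap.isOpen_setOfPred_mapsTo (hL i) (hV i)).preimage (hG i)).mem_nhds
        fun a ha => ha.2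
    filter_upwards [Filter.eventually_all.2 hev] with z' hz' a ha
    obtain ⟨i, hi⟩ := (hmem _ (hw z a)).1 (hz ha)
    rw [hFG] at hi
    exact (hmem _ (hw z' a)).2 ⟨i, by rw [hFG]; exact hz' i ⟨ha, hi⟩⟩

namespace CSeq

variable {P : UnitaryTopOperad} {X : Type u} [TopologicalSpace X] {x₀ : X}

/-- A sequence in `C_𝒫(X)` is determined by its first component. -/
theorem f_apply (α : CSeq P X x₀) (r : ℕ) (θ : P.ops (r + 1)) (i : Fin (r + 1)) :
    α.f r θ i = α.f 0 (P.D r i θ) 0 := by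
  induction r with
  | zero => rw [P.D_zero, Fin.fin_one_eq_zero i]
  | succ r ih =>
    obtain ⟨j, hj⟩ := exists_ne i
    obtain ⟨k, rfl⟩ := Fin.exists_succAbove_eq hj.symm
    rw [← α.compat, ih, P.D_d]

/-- The first component of a sequence in `C_𝒫(X)`. -/
def first (α : CSeq P X x₀) : C(P.ops 1, X) :=
  (ContinuousMap.mk (fun v : Fin 1 → X => v 0) (continuous_apply 0)).comp (α.f 0)

theorem goodMap_first (α : CSeq P X x₀) : GoodMap P x₀ α.first := by
  intro r θ i j hi hj
  refine α.mem_wedge (r + 1) θ i j ?_ ?_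
  · rwa [f_apply]
  · rwa [f_apply]

theorem continuous_first : Continuous (first : CSeq P X x₀ → C(P.ops 1, X)) :=
  (ContinuousMap.continuous_postcomp _).comp ((continuous_apply 0).comp continuous_induced_dom)

end CSeq

namespace GoodMap

variable {P : UnitaryTopOperad} {X : Type u} [TopologicalSpace X] {x₀ : X}

theorem inWedge {f : C(P.ops 1, X)} (hf : GoodMap P x₀ f) (r : ℕ) (θ : P.ops (r + 1)) :
    InWedge x₀ (fun i : Fin (r + 1) => f (P.D r i θ)) := by
  cases r with
  | zero => exact fun i j _ _ => (Fin.fin_one_eq_zero i).trans (Fin.fin_one_eq_zero j).symm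
  | succ r => exact hf r θ

/-- The sequence `(f ∘ D_1, …, f ∘ D_r)_r` determined by `f`. -/
def toCSeq (f : {f : C(P.ops 1, X) // GoodMap P x₀ f}) : CSeq P X x₀ where
  f r := ⟨fun θ i => f.1 (P.D r i θ),
    continuous_pi fun i => f.1.continuous.comp (P.D_continuous r i)⟩
  mem_wedge r θ := f.2.inWedge r θ
  equivariant r σ θ i := congrArg f.1 (P.act_D r σ i θ)
  compat r i θ j := congrArg f.1 (P.D_d r i j θ)

theorem continuous_toCSeq :
    Continuous (toCSeq : {f : C(P.ops 1, X) // GoodMap P x₀ f} → CSeq P X x₀) :=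
  continuous_induced_rng.2 <| continuous_pi fun r =>
    continuous_of_inWedge _ (fun f θ => f.2.inWedge r θ)
      (fun i f => f.1.comp ⟨P.D r i, P.D_continuous r i⟩)
      (fun _ => (ContinuousMap.continuous_precomp _).comp continuous_subtype_val)
      fun _ _ _ => rfl

end GoodMap

/-- The homeomorphism from `C_𝒫(X)` to the distinguished subspace of `Map(𝒫(1), X)`. -/
def CSeq.homeomorph (P : UnitaryTopOperad) (X : Type u) [TopologicalSpace X] (x₀ : X) :
    CSeq P X x₀ ≃ₜ {f : C(P.ops 1, X) // GoodMap P x₀ f} where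
  toFun α := ⟨α.first, α.goodMap_first⟩
  invFun := GoodMap.toCSeq
  left_inv α := by
    have h : (GoodMap.toCSeq ⟨α.first, α.goodMap_first⟩).f = α.f := by
      ext r θ i
      exact (α.f_apply r θ i).symm
    generalize GoodMap.toCSeq ⟨α.first, α.goodMap_first⟩ = β at h ⊢
    cases α
    cases β
    cases h
    rfl
  right_inv f := Subtype.ext <| ContinuousMap.ext fun c => congrArg f.1 (P.D_zero 0 c)
  continuous_toFun := CSeq.continuous_first.subtype_mk _
  continuous_invFun := GoodMap.continuous_toCSeq

theorem statement1 (P : UnitaryTopOperad) :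
    ∃ e : ∀ (X : Type u) [TopologicalSpace X] (x₀ : X),
        CSeq P X x₀ ≃ₜ {f : C(P.ops 1, X) // GoodMap P x₀ f},
      -- the homeomorphism is given by recording the first component of a sequence
      (∀ (X : Type u) [TopologicalSpace X] (x₀ : X) (α : CSeq P X x₀) (c : P.ops 1),
          ((e X x₀ α : {f : C(P.ops 1, X) // GoodMap P x₀ f}) : C(P.ops 1, X)) c = α.f 0 c 0) ∧
      -- for a map `f` in the subspace, every induced map `f_r = (f∘D_1, …, f∘D_r)` lands in
      -- the wedge `X^{∨r}` …
      (∀ (X : Type u) [TopologicalSpace X] (x₀ : X) (f : C(P.ops 1, X)), GoodMap P x₀ f →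
          ∀ (r : ℕ) (θ : P.ops (r + 1)),
            InWedge x₀ (fun i : Fin (r + 1) => f (P.D r i θ))) ∧
      -- … and is `S_r`-equivariant
      (∀ (X : Type u) [TopologicalSpace X] (x₀ : X) (f : C(P.ops 1, X)), GoodMap P x₀ f →
          ∀ (r : ℕ) (σ : Equiv.Perm (Fin (r + 1))) (θ : P.ops (r + 1)) (i : Fin (r + 1)),
            f (P.D r i (P.act (r + 1) σ θ)) = f (P.D r (σ i) θ)) ∧
      -- under the identification, `C_𝒫(φ)` is postcomposition with `φ`
      (∀ (X Y : Type u) [TopologicalSpace X] [TopologicalSpace Y] (x₀ : X) (y₀ : Y)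
          (φ : C(X, Y)) (hφ : φ x₀ = y₀) (α : CSeq P X x₀),
          ((e Y y₀ (CSeq.map φ hφ α) :
              {f : C(P.ops 1, Y) // GoodMap P y₀ f}) : C(P.ops 1, Y))
            = φ.comp ((e X x₀ α : {f : C(P.ops 1, X) // GoodMap P x₀ f}) : C(P.ops 1, X))) := by
  exact ⟨fun X _ x₀ => CSeq.homeomorph P X x₀, fun _ _ _ _ _ => rfl,
    fun _ _ _ _ hf => hf.inWedge, fun _ _ _ f _ r σ θ i => congrArg f (P.act_D r σ i θ),
    fun _ _ _ _ _ _ _ _ _ => rfl⟩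
end

section
/- Let 𝒫 be a unitary topological operad which is reduced, i.e., 𝒫(1) = {*} is a one-point space, and such that 𝒫(2) is nonempty. Then for every pointed space X, the space C_𝒫(X) is a one-point space (the basepoint sequence). In particular, the comonads associated to the (unitary) associative and commutative operads are trivial, and the only counital strictly coassociative coalgebra in pointed spaces is the one-point space. -/
universe u v

/-- Over a reduced operad with a binary operation, every element of `C_𝒫(X)` is the basepoint
sequence: both coordinates of `f₂` are `f₁(id)`, and one of them is the basepoint. -/
theorem CSeq.apply_eq_basepoint {P : UnitaryTopOperad} (hreduced : ∀ x : P.ops 1, x = P.one)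
    (h2 : Nonempty (P.ops 2)) {X : Type u} [TopologicalSpace X] {x₀ : X} (α : CSeq P X x₀)
    (r : ℕ) (θ : P.ops (r + 1)) (i : Fin (r + 1)) : α.f r θ i = x₀ := by
  induction r with
  | zero =>
    obtain ⟨μ⟩ := h2
    by_contra h
    have key : ∀ k : Fin 2, α.f 1 μ (k.succAbove 0) = α.f 0 θ i := fun k => by
      rw [← α.compat 0 k μ 0, hreduced (P.d 1 k μ), hreduced θ, Fin.fin_one_eq_zero i]
    have hne : ∀ k : Fin 2, α.f 1 μ (k.succAbove 0) ≠ x₀ := fun k => by rwa [key k]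
    exact absurd (α.mem_wedge 1 μ _ _ (hne 0) (hne 1)) (by decide)
  | succ r ih =>
    obtain ⟨j, hj⟩ := exists_ne i
    obtain ⟨k, rfl⟩ := Fin.exists_succAbove_eq hj.symm
    rw [← α.compat r j θ k]
    exact ih _ k

theorem statement7 (P : UnitaryTopOperad)
    (hreduced : ∀ x : P.ops 1, x = P.one) (h2 : Nonempty (P.ops 2)) :
    -- the comonad `C_𝒫` is trivial: every element of `C_𝒫(X)` is the basepoint sequence
    (∀ (X : Type u) [TopologicalSpace X] (x₀ : X) (α : CSeq P X x₀) (r : ℕ)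
        (θ : P.ops (r + 1)) (i : Fin (r + 1)), α.f r θ i = x₀) ∧
    (∀ (X : Type u) [TopologicalSpace X] (x₀ : X), Subsingleton (CSeq P X x₀)) ∧
    -- and the only counital strictly coassociative coalgebra in pointed spaces is a point:
    -- a pointed space with a comultiplication into its wedge square whose two projections
    -- are the identity is a one-point space
    (∀ (X : Type u) [TopologicalSpace X] (x₀ : X)
        (c : C(X, {p : X × X // p.1 = x₀ ∨ p.2 = x₀})),
        (∀ x : X, ((c x : X × X)).1 = x) → (∀ x : X, ((c x : X × X)).2 = x) →
        Subsingleton X) := by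
  have hbase : ∀ (X : Type u) [TopologicalSpace X] (x₀ : X) (α : CSeq P X x₀) (r : ℕ)
      (θ : P.ops (r + 1)) (i : Fin (r + 1)), α.f r θ i = x₀ :=
    fun _ _ _ α => α.apply_eq_basepoint hreduced h2
  refine ⟨hbase, fun X _ x₀ => ⟨fun α β => ?_⟩, fun X _ x₀ c h₁ h₂ => ?_⟩
  · have hf : α.f = β.f := by
      funext r
      ext θ i
      rw [hbase X x₀ α, hbase X x₀ β]
    cases α
    cases β
    cases hf
    rfl
  · have hx : ∀ x, x = x₀ := fun x =>
      (c x).2.elim (fun h => (h₁ x).symm.trans h) fun h => (h₂ x).symm.trans h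
    exact ⟨fun x y => (hx x).trans (hx y).symm⟩
end
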